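/- arXiv:1806.05019 — 5 statements merged into one kernel-verified Lean document; each statement's English description precedes it below -/
import Mathlib

section
/- Let ξ: ℝ² → M_m(ℂ) be twice continuously differentiable, of the block form ξ = [[0, v1],[v2, 0]], and satisfy the coupled NLS ξ_t + i j ξ_xx + 2 i j ξ³ = 0 on ℝ². Let A1, A2 ∈ M_n(ℂ), and let continuously differentiable matrix functions Π1, Π2 : ℝ² → ℂ^{n×m} and S : ℝ² → M_n(ℂ) satisfy the equations ∂ₓΠ1 = Π1 q0 + A1 Π1 q1, ∂ₜΠ1 = Π1 Q0 + A1 Π1 Q1 + A1² Π1 Q2; ∂ₓΠ2 = −(Π2 q0* + A2* Π2 q1*), ∂ₜΠ2 = −(Π2 Q0* + A2* Π2 Q1* + (A2*)² Π2 Q2*); ∂ₓS = Π1 q1 Π2*, ∂ₜS = Π1 Q1 Π2* + A1 Π1 Q2 Π2* + Π1 Q2 Π2* A2; together with the identity A1 S(x,t) − S(x,t) A2 = Π1(x,t) Π2(x,t)* for all (x,t) ∈ ℝ². Then at every point (x,t) at which S(x,t) is invertible, the matrix function ξ̃ := ξ + i (j X0 j − X0), where X0 := Π2* S^{-1} Π1,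 satisfies the coupled NLS ξ̃_t + i j ξ̃_xx + 2 i j ξ̃³ = 0. -/
open Matrix Complex

noncomputable section

/-- The signature matrix `j = diag(I_{m1}, -I_{m2})`. -/
def jmat (m1 m2 : ℕ) : Matrix (Fin m1 ⊕ Fin m2) (Fin m1 ⊕ Fin m2) ℂ :=
  Matrix.fromBlocks 1 0 0 (-1)

/-- `q1 = i j`. -/
def q1m (m1 m2 : ℕ) : Matrix (Fin m1 ⊕ Fin m2) (Fin m1 ⊕ Fin m2) ℂ :=
  Complex.I • jmat m1 m2

/-- `q0 = j ξ`. -/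
def q0m (m1 m2 : ℕ) (ξ : ℝ → ℝ → Matrix (Fin m1 ⊕ Fin m2) (Fin m1 ⊕ Fin m2) ℂ) (x t : ℝ) :
    Matrix (Fin m1 ⊕ Fin m2) (Fin m1 ⊕ Fin m2) ℂ :=
  jmat m1 m2 * ξ x t

/-- `Q2 = -2 i j`. -/
def Q2m (m1 m2 : ℕ) : Matrix (Fin m1 ⊕ Fin m2) (Fin m1 ⊕ Fin m2) ℂ :=
  (-(2 * Complex.I)) • jmat m1 m2

/-- `Q1 = -2 j ξ`. -/
def Q1m (m1 m2 : ℕ) (ξ : ℝ → ℝ → Matrix (Fin m1 ⊕ Fin m2) (Fin m1 ⊕ Fin m2) ℂ) (x t : ℝ) :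
    Matrix (Fin m1 ⊕ Fin m2) (Fin m1 ⊕ Fin m2) ℂ :=
  (-2 : ℂ) • (jmat m1 m2 * ξ x t)

/-- `Q0 = i (j ξ² − ξ_x)`. -/
def Q0m (m1 m2 : ℕ) (ξ ξx : ℝ → ℝ → Matrix (Fin m1 ⊕ Fin m2) (Fin m1 ⊕ Fin m2) ℂ) (x t : ℝ) :
    Matrix (Fin m1 ⊕ Fin m2) (Fin m1 ⊕ Fin m2) ℂ :=
  Complex.I • (jmat m1 m2 * (ξ x t) ^ 2 - ξx x t)

/-- `X0 = Pi2* S⁻¹ Pi1`. -/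
def X0m (m1 m2 n : ℕ) (Pi1 Pi2 : ℝ → ℝ → Matrix (Fin n) (Fin m1 ⊕ Fin m2) ℂ)
    (S : ℝ → ℝ → Matrix (Fin n) (Fin n) ℂ) (x t : ℝ) :
    Matrix (Fin m1 ⊕ Fin m2) (Fin m1 ⊕ Fin m2) ℂ :=
  (Pi2 x t)ᴴ * (S x t)⁻¹ * Pi1 x t

/-- The GBDT-transformed potential `ξ̃ = ξ + i (j X0 j − X0)`. -/
def xiT (m1 m2 n : ℕ) (ξ : ℝ → ℝ → Matrix (Fin m1 ⊕ Fin m2) (Fin m1 ⊕ Fin m2) ℂ)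
    (Pi1 Pi2 : ℝ → ℝ → Matrix (Fin n) (Fin m1 ⊕ Fin m2) ℂ)
    (S : ℝ → ℝ → Matrix (Fin n) (Fin n) ℂ) (x t : ℝ) :
    Matrix (Fin m1 ⊕ Fin m2) (Fin m1 ⊕ Fin m2) ℂ :=
  ξ x t + Complex.I • (jmat m1 m2 * X0m m1 m2 n Pi1 Pi2 S x t * jmat m1 m2
    - X0m m1 m2 n Pi1 Pi2 S x t)

end

/-- Entrywise differentiability of a matrix function of a real variable. -/
def HasMatDerivAt {p q : Type*} (F : ℝ → Matrix p q ℂ) (F' : Matrix p q ℂ) (x : ℝ) : Prop :=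
  ∀ i k, HasDerivAt (fun y => F y i k) (F' i k) x

namespace HasMatDerivAt

variable {p q r : Type*} {F G : ℝ → Matrix p q ℂ} {F' G' : Matrix p q ℂ} {x : ℝ}

theorem unique (hF : HasMatDerivAt F F' x) (hG : HasMatDerivAt F G' x) : F' = G' := by
  ext i k
  exact (hF i k).unique (hG i k)

theorem const (A : Matrix p q ℂ) : HasMatDerivAt (fun _ => A) 0 x :=
  fun _ _ => hasDerivAt_const _ _

theorem add (hF : HasMatDerivAt F F' x) (hG : HasMatDerivAt G G' x) :
    HasMatDerivAt (fun y => F y + G y) (F' + G') x :=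
  fun i k => (hF i k).add (hG i k)

theorem neg (hF : HasMatDerivAt F F' x) : HasMatDerivAt (fun y => -F y) (-F') x :=
  fun i k => (hF i k).neg

theorem sub (hF : HasMatDerivAt F F' x) (hG : HasMatDerivAt G G' x) :
    HasMatDerivAt (fun y => F y - G y) (F' - G') x :=
  fun i k => (hF i k).sub (hG i k)

theorem const_smul (c : ℂ) (hF : HasMatDerivAt F F' x) :
    HasMatDerivAt (fun y => c • F y) (c • F') x :=
  fun i k => (hF i k).const_mul c

theorem conjTranspose (hF : HasMatDerivAt F F' x) : HasMatDerivAt (fun y => (F y)ᴴ) F'ᴴ x :=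
  fun i k => (hF k i).star

theorem mul [Fintype q] {G : ℝ → Matrix q r ℂ} {G' : Matrix q r ℂ}
    (hF : HasMatDerivAt F F' x) (hG : HasMatDerivAt G G' x) :
    HasMatDerivAt (fun y => F y * G y) (F' * G x + F x * G') x := by
  intro i k
  simp only [Matrix.mul_apply, Matrix.add_apply, ← Finset.sum_add_distrib]
  exact HasDerivAt.fun_sum fun l _ => (hF i l).mul (hG l k)

theorem const_mul [Fintype q] (A : Matrix r p ℂ) [Fintype p] (hF : HasMatDerivAt F F' x) :
    HasMatDerivAt (fun y => A * F y) (A * F') x := by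
  simpa using (const A).mul hF

theorem mul_const [Fintype q] (A : Matrix q r ℂ) (hF : HasMatDerivAt F F' x) :
    HasMatDerivAt (fun y => F y * A) (F' * A) x := by
  simpa using hF.mul (const A)

open scoped Matrix.Norms.Operator in
theorem iff_hasDerivAt [Fintype p] [Fintype q] :
    HasMatDerivAt F F' x ↔ HasDerivAt F F' x := by
  refine Iff.trans ?_ (hasDerivAt_pi (φ := F) (φ' := F')).symm
  exact forall_congr' fun i => (hasDerivAt_pi (φ := fun y => F y i) (φ' := F' i)).symm

open scoped Matrix.Norms.Operator in
theorem inv [Fintype p] [DecidableEq p] {S : ℝ → Matrix p p ℂ} {S' : Matrix p p ℂ}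
    (hS : HasMatDerivAt S S' x) (hu : IsUnit (S x)) :
    HasMatDerivAt (fun y => (S y)⁻¹) (-((S x)⁻¹ * S' * (S x)⁻¹)) x := by
  rw [iff_hasDerivAt] at hS ⊢
  obtain ⟨u, hu⟩ := hu
  have h := (hu ▸ hasFDerivAt_ringInverse (𝕜 := ℝ) u : HasFDerivAt Ring.inverse
    (-ContinuousLinearMap.mulLeftRight ℝ _ (↑u⁻¹ : Matrix p p ℂ) ↑u⁻¹) (S x)).comp_hasDerivAt x hS
  rw [Matrix.coe_units_inv, hu] at h
  simp only [_root_.neg_apply, ContinuousLinearMap.mulLeftRight_apply] at h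
  simp only [Matrix.nonsing_inv_eq_ringInverse] at h ⊢
  exact h

theorem eventually_isUnit [Fintype p] [DecidableEq p] {S S' : ℝ → Matrix p p ℂ}
    (hS : ∀ y, HasMatDerivAt S (S' y) y) (hu : IsUnit (S x)) : ∀ᶠ y in nhds x, IsUnit (S y) := by
  have hc : Continuous S := continuous_matrix fun i k =>
    continuous_iff_continuousAt.2 fun y => (hS y i k).continuousAt
  simp only [Matrix.isUnit_iff_isUnit_det, isUnit_iff_ne_zero] at hu ⊢
  exact hc.matrix_det.continuousAt.eventually_ne hu

end HasMatDerivAt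

/-- The matrix functions `Π2* S⁻¹ A1ᵏ Π1`. -/
noncomputable def gbdtMoment {p q : Type*} [Fintype p] [DecidableEq p] (A : Matrix p p ℂ)
    (P : Matrix p q ℂ) (Q : Matrix q p ℂ) (S : Matrix p p ℂ) (k : ℕ) : Matrix q q ℂ :=
  Q * S⁻¹ * A ^ k * P

section Moments

variable {p q : Type*} [Fintype p] [DecidableEq p] [Fintype q]
  {P : ℝ → Matrix p q ℂ} {Q : ℝ → Matrix q p ℂ} {S : ℝ → Matrix p p ℂ} {A1 A2 : Matrix p p ℂ}
  {x : ℝ}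

theorem mul_inv_of_sylvester {P : Matrix p q ℂ} {Q : Matrix q p ℂ} {S : Matrix p p ℂ}
    (hu : IsUnit S) (hId : A1 * S - S * A2 = P * Q) :
    A2 * S⁻¹ = S⁻¹ * A1 - S⁻¹ * P * Q * S⁻¹ := by
  have hu' := (Matrix.isUnit_iff_isUnit_det _).1 hu
  rw [Matrix.mul_assoc S⁻¹ P, ← hId]
  simp only [Matrix.mul_sub, Matrix.sub_mul, Matrix.mul_assoc, Matrix.mul_nonsing_inv _ hu',
    Matrix.mul_one, Matrix.nonsing_inv_mul_cancel_left _ _ hu']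
  abel

/-- The spatial derivative of the moments closes up in terms of the moments. -/
theorem hasMatDerivAt_gbdtMoment_space {q0 q1 : Matrix q q ℂ}
    (hP : HasMatDerivAt P (P x * q0 + A1 * P x * q1) x)
    (hQ : HasMatDerivAt Q (-(q0 * Q x + q1 * Q x * A2)) x)
    (hS : HasMatDerivAt S (P x * q1 * Q x) x) (hu : IsUnit (S x))
    (hId : A1 * S x - S x * A2 = P x * Q x) (k : ℕ) {X : ℕ → Matrix q q ℂ}
    (hX : X = gbdtMoment A1 (P x) (Q x) (S x)) :
    HasMatDerivAt (fun y => gbdtMoment A1 (P y) (Q y) (S y) k)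
      (X k * q0 - q0 * X k + (X (k + 1) * q1 - q1 * X (k + 1) + q1 * X 0 * X k - X 0 * q1 * X k))
      x := by
  have h := ((hQ.mul (hS.inv hu)).mul_const (A1 ^ k)).mul hP
  unfold gbdtMoment
  convert h using 1
  have e (Z : Matrix p q ℂ) : A2 * ((S x)⁻¹ * Z) =
      (S x)⁻¹ * (A1 * Z) - (S x)⁻¹ * (P x * (Q x * ((S x)⁻¹ * Z))) := by
    rw [← Matrix.mul_assoc, mul_inv_of_sylvester hu hId]
    simp only [Matrix.sub_mul, Matrix.mul_assoc]
  have c (Z : Matrix p q ℂ) : A1 * (A1 ^ k * Z) = A1 ^ k * (A1 * Z) := by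
    rw [← Matrix.mul_assoc, ← Matrix.mul_assoc, ← pow_succ, ← pow_succ']
  simp only [hX, gbdtMoment, pow_succ, pow_zero, Matrix.mul_add, Matrix.add_mul, Matrix.mul_sub,
    Matrix.mul_neg, Matrix.neg_mul, Matrix.mul_assoc, Matrix.one_mul, e, c]
  abel

theorem hasMatDerivAt_gbdtMoment_time {Q0 Q1 Q2 : Matrix q q ℂ}
    (hP : HasMatDerivAt P (P x * Q0 + A1 * P x * Q1 + A1 ^ 2 * P x * Q2) x)
    (hQ : HasMatDerivAt Q (-(Q0 * Q x + Q1 * Q x * A2 + Q2 * Q x * A2 ^ 2)) x)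
    (hS : HasMatDerivAt S (P x * Q1 * Q x + A1 * (P x * Q2 * Q x) + P x * Q2 * Q x * A2) x)
    (hu : IsUnit (S x)) (hId : A1 * S x - S x * A2 = P x * Q x) {X : ℕ → Matrix q q ℂ}
    (hX : X = gbdtMoment A1 (P x) (Q x) (S x)) {Y1 Y2 : Matrix q q ℂ}
    (hY1 : Y1 = X 1 - X 0 * X 0) (hY2 : Y2 = X 2 - X 0 * X 1 - Y1 * X 0) :
    HasMatDerivAt (fun y => gbdtMoment A1 (P y) (Q y) (S y) 0)
      (X 0 * Q0 + X 1 * Q1 + X 2 * Q2 - (Q0 * X 0 + Q1 * Y1 + Q2 * Y2)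
        - (X 0 * Q1 * X 0 + X 1 * Q2 * X 0 + X 0 * Q2 * Y1)) x := by
  have h := ((hQ.mul (hS.inv hu)).mul_const (A1 ^ 0)).mul hP
  unfold gbdtMoment
  convert h using 1
  have e (Z : Matrix p q ℂ) : A2 * ((S x)⁻¹ * Z) =
      (S x)⁻¹ * (A1 * Z) - (S x)⁻¹ * (P x * (Q x * ((S x)⁻¹ * Z))) := by
    rw [← Matrix.mul_assoc, mul_inv_of_sylvester hu hId]
    simp only [Matrix.sub_mul, Matrix.mul_assoc]
  simp only [hY2, hY1, hX, gbdtMoment, pow_two, pow_one, pow_zero, Matrix.mul_add,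
    Matrix.add_mul, Matrix.mul_sub, Matrix.sub_mul, Matrix.mul_neg, Matrix.neg_mul,
    Matrix.mul_assoc, Matrix.one_mul, e]
  abel

end Moments

theorem exists_even_add_odd {R : Type*} [Ring R] [Algebra ℂ R] {j : R} (hjj : j * j = 1) (X : R) :
    ∃ a b, X = a + b ∧ a * j = j * a ∧ b * j = -(j * b) := by
  have hjj' (z : R) : j * (j * z) = z := by rw [← mul_assoc, hjj, one_mul]
  refine ⟨(2⁻¹ : ℂ) • (X + j * X * j), (2⁻¹ : ℂ) • (X - j * X * j), ?_, ?_, ?_⟩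
  · module
  all_goals
    simp only [mul_add, add_mul, mul_sub, sub_mul, mul_assoc, mul_smul_comm, smul_mul_assoc, hjj,
      hjj', mul_one]
    module

theorem jmat_mul_self (m1 m2 : ℕ) : jmat m1 m2 * jmat m1 m2 = 1 := by
  simp [jmat, Matrix.fromBlocks_multiply]

/-- The purely algebraic part: in a `ℂ`-algebra graded by the involution `j`, the dressed potential
solves the coupled NLS once the derivatives of `X0` and `X1` are given by the moment equations. -/
theorem darboux_coupled_NLS {R : Type*} [Ring R] [Algebra ℂ R] {j ξ ξx ξxx a b a1 b1 a2 b2 : R}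
    (hjj : j * j = 1) (hξ : ξ * j = -(j * ξ)) (hξx : ξx * j = -(j * ξx))
    (ha : a * j = j * a) (hb : b * j = -(j * b))
    (ha1 : a1 * j = j * a1) (hb1 : b1 * j = -(j * b1))
    (ha2 : a2 * j = j * a2) (hb2 : b2 * j = -(j * b2))
    {ξt X0 X1 X2 X0x X1x X0xx X0t Y1 Y2 : R}
    (hX0 : X0 = a + b) (hX1 : X1 = a1 + b1) (hX2 : X2 = a2 + b2)
    (hNLS : ξt + I • (j * ξxx) + (2 * I) • (j * ξ ^ 3) = 0)
    (hX0x : X0x = X0 * (j * ξ) - j * ξ * X0 + I • (X1 * j - j * X1 + j * X0 * X0 - X0 * j * X0))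
    (hX1x : X1x = X1 * (j * ξ) - j * ξ * X1 + I • (X2 * j - j * X2 + j * X0 * X1 - X0 * j * X1))
    (hX0xx : X0xx = X0x * (j * ξ) + X0 * (j * ξx) - (j * ξx * X0 + j * ξ * X0x) +
      I • (X1x * j - j * X1x + (j * X0x * X0 + j * X0 * X0x)
        - (X0x * j * X0 + X0 * j * X0x)))
    (hY1 : Y1 = X1 - X0 * X0) (hY2 : Y2 = X2 - X0 * X1 - Y1 * X0)
    (hX0t : X0t = X0 * (I • (j * ξ ^ 2 - ξx)) + X1 * ((-2 : ℂ) • (j * ξ))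
      + X2 * ((-(2 * I)) • j)
      - ((I • (j * ξ ^ 2 - ξx)) * X0 + ((-2 : ℂ) • (j * ξ)) * Y1 + ((-(2 * I)) • j) * Y2)
      - (X0 * ((-2 : ℂ) • (j * ξ)) * X0 + X1 * ((-(2 * I)) • j) * X0
        + X0 * ((-(2 * I)) • j) * Y1)) :
    ξt + I • (j * X0t * j - X0t) + I • (j * (ξxx + I • (j * X0xx * j - X0xx)))
      + (2 * I) • (j * (ξ + I • (j * X0 * j - X0)) ^ 3) = 0 := by
  have hjj' (z : R) : j * (j * z) = z := by rw [← mul_assoc, hjj, one_mul]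
  have comm {a : R} (ha : a * j = j * a) (z : R) : a * (j * z) = j * (a * z) := by
    rw [← mul_assoc, ha, mul_assoc]
  have acomm {a : R} (ha : a * j = -(j * a)) (z : R) : a * (j * z) = -(j * (a * z)) := by
    rw [← mul_assoc, ha, neg_mul, mul_assoc]
  have e : ξt = -(I • (j * ξxx)) - (2 * I) • (j * ξ ^ 3) := by
    rw [add_assoc] at hNLS
    rw [eq_neg_of_add_eq_zero_left hNLS]
    abel
  rw [e, hX0t, hX0xx, hX0x, hX1x, hY2, hY1, hX0, hX1, hX2]
  simp only [pow_succ, pow_zero, one_mul, mul_add, add_mul, mul_sub, sub_mul, mul_assoc, hξ, hξx,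
    ha, hb, ha1, hb1, ha2, hb2, acomm hξ, acomm hξx, comm ha, acomm hb, comm ha1,
    acomm hb1, mul_neg, neg_mul, hjj', mul_smul_comm, smul_mul_assoc]
  match_scalars <;> ring_nf <;> simp only [I_sq, I_pow_three, I_pow_four] <;> ring_nf

/-- Proposition 2.1, GBDT for the coupled NLS: if `ξ` satisfies the coupled
NLS `ξ_t + i j ξ_xx + 2 i j ξ³ = 0` and `Pi1, Pi2, S` satisfy the GBDT linear systems together
with the identity `A1 S − S A2 = Pi1 Pi2*`, then at every point of invertibility of `S` the
matrix function `ξ̃ = ξ + i (j X0 j − X0)`, `X0 = Pi2* S⁻¹ Pi1`, satisfies the coupled NLS. -/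
theorem gbdt_coupled_NLS (m1 m2 n : ℕ)
    (v1 : ℝ → ℝ → Matrix (Fin m1) (Fin m2) ℂ)
    (v2 : ℝ → ℝ → Matrix (Fin m2) (Fin m1) ℂ)
    (ξ ξx ξxx ξt : ℝ → ℝ → Matrix (Fin m1 ⊕ Fin m2) (Fin m1 ⊕ Fin m2) ℂ)
    (hblock : ∀ x t, ξ x t = Matrix.fromBlocks 0 (v1 x t) (v2 x t) 0)
    (hξx : ∀ x t, ∀ i k, HasDerivAt (fun x' => ξ x' t i k) (ξx x t i k) x)
    (hξxx : ∀ x t, ∀ i k, HasDerivAt (fun x' => ξx x' t i k) (ξxx x t i k) x)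
    (hξt : ∀ x t, ∀ i k, HasDerivAt (fun t' => ξ x t' i k) (ξt x t i k) t)
    (hC2 : ∀ i k, Continuous (fun p : ℝ × ℝ => ξx p.1 p.2 i k)
      ∧ Continuous (fun p : ℝ × ℝ => ξxx p.1 p.2 i k)
      ∧ Continuous (fun p : ℝ × ℝ => ξt p.1 p.2 i k))
    (hNLS : ∀ x t, ξt x t + Complex.I • (jmat m1 m2 * ξxx x t)
      + (2 * Complex.I) • (jmat m1 m2 * (ξ x t) ^ 3) = 0)
    (A1 A2 : Matrix (Fin n) (Fin n) ℂ)
    (Pi1 Pi2 : ℝ → ℝ → Matrix (Fin n) (Fin m1 ⊕ Fin m2) ℂ)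
    (S : ℝ → ℝ → Matrix (Fin n) (Fin n) ℂ)
    (hPi1x : ∀ x t, ∀ i k, HasDerivAt (fun x' => Pi1 x' t i k)
      ((Pi1 x t * q0m m1 m2 ξ x t + A1 * Pi1 x t * q1m m1 m2) i k) x)
    (hPi1t : ∀ x t, ∀ i k, HasDerivAt (fun t' => Pi1 x t' i k)
      (((Pi1 x t * Q0m m1 m2 ξ ξx x t + A1 * Pi1 x t * Q1m m1 m2 ξ x t
        + A1 ^ 2 * Pi1 x t * Q2m m1 m2 : Matrix (Fin n) (Fin m1 ⊕ Fin m2) ℂ)) i k) t)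
    (hPi2x : ∀ x t, ∀ i k, HasDerivAt (fun x' => Pi2 x' t i k)
      ((-(Pi2 x t * (q0m m1 m2 ξ x t)ᴴ + A2ᴴ * Pi2 x t * (q1m m1 m2)ᴴ)) i k) x)
    (hPi2t : ∀ x t, ∀ i k, HasDerivAt (fun t' => Pi2 x t' i k)
      (((-(Pi2 x t * (Q0m m1 m2 ξ ξx x t)ᴴ + A2ᴴ * Pi2 x t * (Q1m m1 m2 ξ x t)ᴴ
        + (A2ᴴ) ^ 2 * Pi2 x t * (Q2m m1 m2)ᴴ) : Matrix (Fin n) (Fin m1 ⊕ Fin m2) ℂ)) i k) t)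
    (hSx : ∀ x t, ∀ i k, HasDerivAt (fun x' => S x' t i k)
      ((Pi1 x t * q1m m1 m2 * (Pi2 x t)ᴴ) i k) x)
    (hSt : ∀ x t, ∀ i k, HasDerivAt (fun t' => S x t' i k)
      ((Pi1 x t * Q1m m1 m2 ξ x t * (Pi2 x t)ᴴ + A1 * (Pi1 x t * Q2m m1 m2 * (Pi2 x t)ᴴ)
        + Pi1 x t * Q2m m1 m2 * (Pi2 x t)ᴴ * A2) i k) t)
    (hId : ∀ x t, A1 * S x t - S x t * A2 = Pi1 x t * (Pi2 x t)ᴴ) :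
    ∀ x t, IsUnit (S x t) →
      ((∀ i k, DifferentiableAt ℝ (fun t' => xiT m1 m2 n ξ Pi1 Pi2 S x t' i k) t)
      ∧ (∀ i k, DifferentiableAt ℝ (fun x' => xiT m1 m2 n ξ Pi1 Pi2 S x' t i k) x)
      ∧ (∀ i k, DifferentiableAt ℝ
          (fun x' => deriv (fun x'' => xiT m1 m2 n ξ Pi1 Pi2 S x'' t i k) x') x)
      ∧ (Matrix.of fun i k => deriv (fun t' => xiT m1 m2 n ξ Pi1 Pi2 S x t' i k) t)
        + Complex.I • (jmat m1 m2 * Matrix.of fun i k =>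
            deriv (fun x' => deriv (fun x'' => xiT m1 m2 n ξ Pi1 Pi2 S x'' t i k) x') x)
        + (2 * Complex.I) • (jmat m1 m2 * (xiT m1 m2 n ξ Pi1 Pi2 S x t) ^ 3) = 0) := by
  intro x t hu
  set j := jmat m1 m2 with hj
  have hjj : j * j = 1 := jmat_mul_self m1 m2
  have hjH : jᴴ = j := by simp [hj, jmat, Matrix.fromBlocks_conjTranspose]
  have hξj (x t) : ξ x t * j = -(j * ξ x t) := by
    simp [hblock, hj, jmat, Matrix.fromBlocks_multiply, Matrix.fromBlocks_neg]
  have hξxj : ξx x t * j = -(j * ξx x t) := by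
    have h := HasMatDerivAt.mul_const j (hξx x t)
    simp only [hξj] at h
    exact h.unique (HasMatDerivAt.const_mul j (hξx x t)).neg
  set X : ℝ → ℝ → ℕ → Matrix (Fin m1 ⊕ Fin m2) (Fin m1 ⊕ Fin m2) ℂ :=
    fun x t => gbdtMoment A1 (Pi1 x t) (Pi2 x t)ᴴ (S x t) with hX
  have hX0 (x t) : X0m m1 m2 n Pi1 Pi2 S x t = X x t 0 := by simp [hX, X0m, gbdtMoment]
  set Xx : ℝ → ℝ → ℕ → Matrix (Fin m1 ⊕ Fin m2) (Fin m1 ⊕ Fin m2) ℂ :=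
    fun x t k => X x t k * (j * ξ x t) - j * ξ x t * X x t k + I • (X x t (k + 1) * j
      - j * X x t (k + 1) + j * X x t 0 * X x t k - X x t 0 * j * X x t k) with hXx
  have hXderiv (x t) (hu : IsUnit (S x t)) (k) :
      HasMatDerivAt (fun y => X y t k) (Xx x t k) x := by
    have hQ := HasMatDerivAt.conjTranspose (hPi2x x t)
    have h := hasMatDerivAt_gbdtMoment_space (Q := fun y => (Pi2 y t)ᴴ) (A2 := A2)
      (q0 := q0m m1 m2 ξ x t) (q1 := q1m m1 m2) (hPi1x x t)
      (by simpa [Matrix.mul_assoc] using hQ) (hSx x t) hu (hId x t) k rfl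
    convert h using 1
    simp only [hXx, hX, q0m, q1m, ← hj, mul_smul_comm, smul_mul_assoc]
    module
  set Xxx := Xx x t 0 * (j * ξ x t) + X x t 0 * (j * ξx x t)
      - (j * ξx x t * X x t 0 + j * ξ x t * Xx x t 0) + I • (Xx x t 1 * j - j * Xx x t 1
      + (j * Xx x t 0 * X x t 0 + j * X x t 0 * Xx x t 0)
      - (Xx x t 0 * j * X x t 0 + X x t 0 * j * Xx x t 0)) with hXxx
  have hXxderiv : HasMatDerivAt (fun y => Xx y t 0) Xxx x := by
    have h0 := hXderiv x t hu 0
    have h1 := hXderiv x t hu 1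
    have hjξ := HasMatDerivAt.const_mul j (hξx x t)
    exact ((h0.mul hjξ).sub (hjξ.mul h0)).add (((((h1.mul_const j).sub (h1.const_mul j)).add
      ((h0.const_mul j).mul h0)).sub ((h0.mul_const j).mul h0)).const_smul I)
  obtain ⟨Y1, hY1⟩ : ∃ Y, Y = X x t 1 - X x t 0 * X x t 0 := ⟨_, rfl⟩
  obtain ⟨Y2, hY2⟩ : ∃ Y, Y = X x t 2 - X x t 0 * X x t 1 - Y1 * X x t 0 := ⟨_, rfl⟩
  have hXt := hasMatDerivAt_gbdtMoment_time (Q := fun s => (Pi2 x s)ᴴ) (A2 := A2)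
    (Q0 := Q0m m1 m2 ξ ξx x t) (Q1 := Q1m m1 m2 ξ x t) (Q2 := Q2m m1 m2) (hPi1t x t)
    (by simpa [Matrix.mul_assoc] using HasMatDerivAt.conjTranspose (hPi2t x t))
    (hSt x t) hu (hId x t) (X := X x t) rfl hY1 hY2
  change HasMatDerivAt (fun s => X x s 0) _ t at hXt
  have gauge {F G : ℝ → Matrix (Fin m1 ⊕ Fin m2) (Fin m1 ⊕ Fin m2) ℂ} {F' G'} {s : ℝ}
      (hF : HasMatDerivAt F F' s) (hG : HasMatDerivAt G G' s) :
      HasMatDerivAt (fun y => F y + I • (j * G y * j - G y)) (F' + I • (j * G' * j - G')) s :=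
    hF.add ((((hG.const_mul j).mul_const j).sub hG).const_smul I)
  have hxiT : xiT m1 m2 n ξ Pi1 Pi2 S = fun x t => ξ x t + I • (j * X x t 0 * j - X x t 0) := by
    funext x t
    rw [xiT, hX0]
  have ht := gauge (hξt x t) hXt
  have hx (y) (hy : IsUnit (S y t)) := gauge (hξx y t) (hXderiv y t hy 0)
  have hxx := gauge (hξxx x t) hXxderiv
  have hderiv (i k) : HasDerivAt
      (fun x' => deriv (fun x'' => xiT m1 m2 n ξ Pi1 Pi2 S x'' t i k) x')
      ((ξxx x t + I • (j * Xxx * j - Xxx)) i k) x := by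
    refine (hxx i k).congr_of_eventuallyEq ?_
    filter_upwards [HasMatDerivAt.eventually_isUnit (fun y => hSx y t) hu] with y hy
    rw [hxiT]
    exact (hx y hy i k).deriv
  refine ⟨fun i k => ?_, fun i k => ?_, fun i k => (hderiv i k).differentiableAt, ?_⟩
  · rw [hxiT]
    exact (ht i k).differentiableAt
  · rw [hxiT]
    exact (hx x hu i k).differentiableAt
  · simp only [(hderiv _ _).deriv]
    simp only [hxiT, (ht _ _).deriv]
    obtain ⟨a, b, hX0, ha, hb⟩ := exists_even_add_odd hjj (X x t 0)
    obtain ⟨a1, b1, hX1, ha1, hb1⟩ := exists_even_add_odd hjj (X x t 1)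
    obtain ⟨a2, b2, hX2, ha2, hb2⟩ := exists_even_add_odd hjj (X x t 2)
    exact darboux_coupled_NLS hjj (hξj x t) hξxj ha hb ha1 hb1 ha2 hb2 hX0 hX1 hX2 (hNLS x t) rfl
      rfl rfl hY1 hY2 rfl
end

section
/- Let A1, A2 ∈ M_n(ℂ), let q0, Q0, Q1 : ℝ² → M_m(ℂ) be continuous matrix functions and q1, Q2 ∈ M_m(ℂ) constant matrices, and let continuously differentiable matrix functions Π1, Π2 : ℝ² → ℂ^{n×m} and S : ℝ² → M_n(ℂ) satisfy ∂ₓΠ1 = Π1 q0 + A1 Π1 q1, ∂ₜΠ1 = Π1 Q0 + A1 Π1 Q1 + A1² Π1 Q2; ∂ₓΠ2 = −(Π2 q0* + A2* Π2 q1*), ∂ₜΠ2 = −(Π2 Q0* + A2* Π2 Q1* + (A2*)² Π2 Q2*); ∂ₓS = Π1 q1 Π2*, ∂ₜS = Π1 Q1 Π2* + A1 Π1 Q2 Π2* + Π1 Q2 Π2* A2. If the matrix identity A1 S(0,0) − S(0,0) A2 = Π1(0,0) Π2(0,0)* holds at the point (0,0), then A1 S(x,t) − S(x,t) A2 = Π1(x,t)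 Π2(x,t)* holds for all (x,t) ∈ ℝ². -/
open Matrix Complex

/-- The entrywise product rule for a product of two matrix-valued curves. -/
theorem hasDerivAt_matrix_mul_apply {l m n : ℕ}
    {P P' : ℝ → Matrix (Fin l) (Fin m) ℂ} {R R' : ℝ → Matrix (Fin m) (Fin n) ℂ} {s : ℝ}
    (hP : ∀ i k, HasDerivAt (fun u => P u i k) (P' s i k) s)
    (hR : ∀ i k, HasDerivAt (fun u => R u i k) (R' s i k) s) (i : Fin l) (k : Fin n) :
    HasDerivAt (fun u => (P u * R u) i k) ((P' s * R s + P s * R' s) i k) s := by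
  simp only [Matrix.add_apply, Matrix.mul_apply, ← Finset.sum_add_distrib]
  exact HasDerivAt.fun_sum fun j _ => (hP i j).mul (hR j k)

/-- If the derivatives of `A1 S - S A2` and `P R*` agree along a curve, then the difference of
the two is constant along it. -/
theorem sylvester_defect_eq_of_hasDerivAt {m n : ℕ} (A1 A2 : Matrix (Fin n) (Fin n) ℂ)
    {P P' R R' : ℝ → Matrix (Fin n) (Fin m) ℂ} {S S' : ℝ → Matrix (Fin n) (Fin n) ℂ}
    (hP : ∀ s i k, HasDerivAt (fun u => P u i k) (P' s i k) s)
    (hR : ∀ s i k, HasDerivAt (fun u => R u i k) (R' s i k) s)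
    (hS : ∀ s i k, HasDerivAt (fun u => S u i k) (S' s i k) s)
    (h : ∀ s, A1 * S' s - S' s * A2 = P' s * (R s)ᴴ + P s * (R' s)ᴴ) (a b : ℝ) :
    A1 * S a - S a * A2 - P a * (R a)ᴴ = A1 * S b - S b * A2 - P b * (R b)ᴴ := by
  have hconst (B : Matrix (Fin n) (Fin n) ℂ) (s : ℝ) (i k : Fin n) :
      HasDerivAt (fun _ : ℝ => B i k) ((0 : Matrix (Fin n) (Fin n) ℂ) i k) s :=
    hasDerivAt_const s (B i k)
  have hD (s : ℝ) (i k : Fin n) :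
      HasDerivAt (fun u => (A1 * S u - S u * A2 - P u * (R u)ᴴ) i k) 0 s := by
    have h1 := hasDerivAt_matrix_mul_apply (P := fun _ => A1) (P' := fun _ => 0)
      (hconst A1 s) (hS s) i k
    have h2 := hasDerivAt_matrix_mul_apply (R := fun _ => A2) (R' := fun _ => 0)
      (hS s) (hconst A2 s) i k
    have h3 := hasDerivAt_matrix_mul_apply (R := fun u => (R u)ᴴ) (R' := fun u => (R' u)ᴴ)
      (hP s) (fun i k => (hR s k i).star) i k
    refine ((h1.sub h2).sub h3).congr_deriv ?_
    rw [← Matrix.sub_apply, ← Matrix.sub_apply, ← h s]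
    simp
  ext i k
  exact is_const_of_deriv_eq_zero (fun s => (hD s i k).differentiableAt)
    (fun s => (hD s i k).deriv) a b

/-- Remark 2.3: if `Π1, Π2, S` satisfy the GBDT linear systems and the
matrix identity `A1 S − S A2 = Π1 Π2*` holds at `(0,0)`, then it holds everywhere on `ℝ²`. -/
theorem gbdt_matrix_identity_propagates (m n : ℕ)
    (A1 A2 : Matrix (Fin n) (Fin n) ℂ)
    (q0 Q0 Q1 : ℝ → ℝ → Matrix (Fin m) (Fin m) ℂ)
    (q1 Q2 : Matrix (Fin m) (Fin m) ℂ)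
    (hq0 : ∀ i k, Continuous (fun p : ℝ × ℝ => q0 p.1 p.2 i k))
    (hQ0 : ∀ i k, Continuous (fun p : ℝ × ℝ => Q0 p.1 p.2 i k))
    (hQ1 : ∀ i k, Continuous (fun p : ℝ × ℝ => Q1 p.1 p.2 i k))
    (Pi1 Pi2 : ℝ → ℝ → Matrix (Fin n) (Fin m) ℂ)
    (S : ℝ → ℝ → Matrix (Fin n) (Fin n) ℂ)
    (hPi1x : ∀ x t, ∀ i k, HasDerivAt (fun x' => Pi1 x' t i k)
      ((Pi1 x t * q0 x t + A1 * Pi1 x t * q1) i k) x)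
    (hPi1t : ∀ x t, ∀ i k, HasDerivAt (fun t' => Pi1 x t' i k)
      (((Pi1 x t * Q0 x t + A1 * Pi1 x t * Q1 x t
        + A1 ^ 2 * Pi1 x t * Q2 : Matrix (Fin n) (Fin m) ℂ)) i k) t)
    (hPi2x : ∀ x t, ∀ i k, HasDerivAt (fun x' => Pi2 x' t i k)
      ((-(Pi2 x t * (q0 x t)ᴴ + A2ᴴ * Pi2 x t * q1ᴴ)) i k) x)
    (hPi2t : ∀ x t, ∀ i k, HasDerivAt (fun t' => Pi2 x t' i k)
      (((-(Pi2 x t * (Q0 x t)ᴴ + A2ᴴ * Pi2 x t * (Q1 x t)ᴴ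
        + (A2ᴴ) ^ 2 * Pi2 x t * Q2ᴴ) : Matrix (Fin n) (Fin m) ℂ)) i k) t)
    (hSx : ∀ x t, ∀ i k, HasDerivAt (fun x' => S x' t i k)
      ((Pi1 x t * q1 * (Pi2 x t)ᴴ) i k) x)
    (hSt : ∀ x t, ∀ i k, HasDerivAt (fun t' => S x t' i k)
      ((Pi1 x t * Q1 x t * (Pi2 x t)ᴴ + A1 * (Pi1 x t * Q2 * (Pi2 x t)ᴴ)
        + Pi1 x t * Q2 * (Pi2 x t)ᴴ * A2) i k) t)
    (hId0 : A1 * S 0 0 - S 0 0 * A2 = Pi1 0 0 * (Pi2 0 0)ᴴ) :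
    ∀ x t : ℝ, A1 * S x t - S x t * A2 = Pi1 x t * (Pi2 x t)ᴴ := by
  intro x t
  have hx := sylvester_defect_eq_of_hasDerivAt A1 A2
    (fun s => hPi1x s 0) (fun s => hPi2x s 0) (fun s => hSx s 0)
    (fun s => by
      simp only [conjTranspose_neg, conjTranspose_add, conjTranspose_mul,
        conjTranspose_conjTranspose, Matrix.add_mul, Matrix.mul_add, Matrix.mul_neg,
        Matrix.mul_assoc]
      abel) x 0
  have ht := sylvester_defect_eq_of_hasDerivAt A1 A2
    (hPi1t x) (hPi2t x) (hSt x)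
    (fun s => by
      simp only [conjTranspose_neg, conjTranspose_add, conjTranspose_mul,
        conjTranspose_conjTranspose, Matrix.add_mul, Matrix.mul_add, Matrix.mul_neg,
        Matrix.mul_assoc, pow_two]
      abel) t 0
  exact sub_eq_zero.mp (ht.trans (hx.trans (sub_eq_zero.mpr hId0)))
end

section
/- Let ξ: ℝ² → M_m(ℂ) be twice continuously differentiable, of the block form ξ = [[0, v1],[v2, 0]], and satisfy the coupled NLS ξ_t + i j ξ_xx + 2 i j ξ³ = 0. Let A1, A2 ∈ M_n(ℂ), and let C¹ matrix functions Π1, Π2 : ℝ² → ℂ^{n×m}, S : ℝ² → M_n(ℂ) satisfy ∂ₓΠ1 = Π1 q0 + A1 Π1 q1, ∂ₜΠ1 = Π1 Q0 + A1 Π1 Q1 + A1² Π1 Q2; ∂ₓΠ2 = −(Π2 q0* + A2* Π2 q1*), ∂ₜΠ2 = −(Π2 Q0* + A2* Π2 Q1* + (A2*)² Π2 Q2*); ∂ₓS = Π1 q1 Π2*, ∂ₜS = Π1 Q1 Π2* + A1 Π1 Q2 Π2* + Π1 Q2 Π2* A2, and the identity A1 S − S A2 = Π1 Π2* on ℝ².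 Fix z ∈ ℂ that is not an eigenvalue of A1, let Ω ⊆ ℝ² be an open set on which S(x,t) is invertible, and let w : Ω → M_m(ℂ) be differentiable and satisfy w_x = G w and w_t = F w, where G = −(z q1 + q0) and F = −(z² Q2 + z Q1 + Q0). Define ξ̃ := ξ + i (j X0 j − X0) with X0 := Π2* S^{-1} Π1, and the Darboux matrix w_A(x,t,z) := I_m − Π2(x,t)* S(x,t)^{-1} (A1 − z I_n)^{-1} Π1(x,t). Then w̃ := w_A w satisfies w̃_x = G̃ w̃ and w̃_t = F̃ w̃ on Ω, where G̃ = −(z q̃1 + q̃0), F̃ = −(z² Q̃2 + z Q̃1 + Q̃0) with q̃1 = i j, q̃0 = j ξ̃, Q̃2 = −2 i j, Q̃1 = −2 j ξ̃, Q̃0 = i (j ξ̃² − ξ̃_x). -/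
open Matrix Complex

noncomputable section

/-- `G = −(z q1 + q0)`. -/
def Gm (m1 m2 : ℕ) (ξ : ℝ → ℝ → Matrix (Fin m1 ⊕ Fin m2) (Fin m1 ⊕ Fin m2) ℂ)
    (z : ℂ) (x t : ℝ) : Matrix (Fin m1 ⊕ Fin m2) (Fin m1 ⊕ Fin m2) ℂ :=
  -(z • q1m m1 m2 + q0m m1 m2 ξ x t)

/-- `F = −(z² Q2 + z Q1 + Q0)`. -/
def Fm (m1 m2 : ℕ) (ξ ξx : ℝ → ℝ → Matrix (Fin m1 ⊕ Fin m2) (Fin m1 ⊕ Fin m2) ℂ)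
    (z : ℂ) (x t : ℝ) : Matrix (Fin m1 ⊕ Fin m2) (Fin m1 ⊕ Fin m2) ℂ :=
  -(z ^ 2 • Q2m m1 m2 + z • Q1m m1 m2 ξ x t + Q0m m1 m2 ξ ξx x t)

/-- The partial derivative `ξ̃_x` of the transformed potential, entrywise. -/
def xiTx (m1 m2 n : ℕ) (ξ : ℝ → ℝ → Matrix (Fin m1 ⊕ Fin m2) (Fin m1 ⊕ Fin m2) ℂ)
    (Pi1 Pi2 : ℝ → ℝ → Matrix (Fin n) (Fin m1 ⊕ Fin m2) ℂ)
    (S : ℝ → ℝ → Matrix (Fin n) (Fin n) ℂ) (x t : ℝ) :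
    Matrix (Fin m1 ⊕ Fin m2) (Fin m1 ⊕ Fin m2) ℂ :=
  Matrix.of fun i k => deriv (fun x' => xiT m1 m2 n ξ Pi1 Pi2 S x' t i k) x

/-- The Darboux matrix `w_A = I − Π2* S⁻¹ (A1 − z I)⁻¹ Π1`. -/
def wAm (m1 m2 n : ℕ) (A1 : Matrix (Fin n) (Fin n) ℂ)
    (Pi1 Pi2 : ℝ → ℝ → Matrix (Fin n) (Fin m1 ⊕ Fin m2) ℂ)
    (S : ℝ → ℝ → Matrix (Fin n) (Fin n) ℂ) (x t : ℝ) (z : ℂ) :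
    Matrix (Fin m1 ⊕ Fin m2) (Fin m1 ⊕ Fin m2) ℂ :=
  1 - (Pi2 x t)ᴴ * (S x t)⁻¹ * (A1 - z • 1)⁻¹ * Pi1 x t

end

/-- Entrywise differentiability at a point of a matrix function of a real variable. -/
def HasEntryDerivAt {α β : Type*} (M : ℝ → Matrix α β ℂ) (M' : Matrix α β ℂ) (s : ℝ) : Prop :=
  ∀ i k, HasDerivAt (fun s' => M s' i k) (M' i k) s

namespace HasEntryDerivAt

variable {α β γ : Type*} {s : ℝ}

theorem mul [Fintype β] {M : ℝ → Matrix α β ℂ} {N : ℝ → Matrix β γ ℂ} {M' : Matrix α β ℂ}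
    {N' : Matrix β γ ℂ} (hM : HasEntryDerivAt M M' s) (hN : HasEntryDerivAt N N' s) :
    HasEntryDerivAt (fun s' => M s' * N s') (M' * N s + M s * N') s := by
  intro i k
  simp only [Matrix.add_apply, Matrix.mul_apply, ← Finset.sum_add_distrib]
  exact HasDerivAt.fun_sum fun l _ => (hM i l).mul (hN l k)

theorem add {M N : ℝ → Matrix α β ℂ} {M' N' : Matrix α β ℂ}
    (hM : HasEntryDerivAt M M' s) (hN : HasEntryDerivAt N N' s) :
    HasEntryDerivAt (fun s' => M s' + N s') (M' + N') s :=
  fun i k => (hM i k).add (hN i k)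

theorem sub {M N : ℝ → Matrix α β ℂ} {M' N' : Matrix α β ℂ}
    (hM : HasEntryDerivAt M M' s) (hN : HasEntryDerivAt N N' s) :
    HasEntryDerivAt (fun s' => M s' - N s') (M' - N') s :=
  fun i k => (hM i k).sub (hN i k)

theorem const_smul (c : ℂ) {M : ℝ → Matrix α β ℂ} {M' : Matrix α β ℂ}
    (hM : HasEntryDerivAt M M' s) : HasEntryDerivAt (fun s' => c • M s') (c • M') s :=
  fun i k => (hM i k).const_smul c

theorem const (C : Matrix α β ℂ) : HasEntryDerivAt (fun _ => C) 0 s :=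
  fun i k => hasDerivAt_const s (C i k)

theorem conjTranspose {M : ℝ → Matrix α β ℂ} {M' : Matrix α β ℂ}
    (hM : HasEntryDerivAt M M' s) : HasEntryDerivAt (fun s' => (M s')ᴴ) M'ᴴ s :=
  fun i k => (hM k i).star

open scoped Matrix.Norms.Operator in
theorem inv [Fintype α] [DecidableEq α] {M : ℝ → Matrix α α ℂ} {M' : Matrix α α ℂ}
    (hM : HasEntryDerivAt M M' s) (hu : IsUnit (M s)) :
    HasEntryDerivAt (fun s' => (M s')⁻¹) (-((M s)⁻¹ * M' * (M s)⁻¹)) s := by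
  have hd : HasDerivAt M M' s :=
    hasDerivAt_pi.2 fun i => hasDerivAt_pi.2 fun k => hM i k
  obtain ⟨u, hu⟩ := hu
  have h1 : HasFDerivAt Ring.inverse _ (M s) := hu ▸ hasFDerivAt_ringInverse (𝕜 := ℝ) u
  have h2 := h1.comp_hasDerivAt s hd
  have h3 := fun i k => hasDerivAt_pi.1 (hasDerivAt_pi.1 h2 i) k
  intro i k
  have := h3 i k
  simpa [Function.comp_def, ← Matrix.nonsing_inv_eq_ringInverse, ← hu] using this

end HasEntryDerivAt

section Dressing

variable {μ ν : Type*} [Fintype μ] [Fintype ν] [DecidableEq μ] [DecidableEq ν]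
  {A1 A2 : Matrix ν ν ℂ} {B : ℝ → Matrix ν μ ℂ} {P : ℝ → Matrix μ ν ℂ} {S : ℝ → Matrix ν ν ℂ}
  {Q0 Q1 Q2 : Matrix μ μ ℂ} {s : ℝ}

/-- The transformed zeroth coefficient of a quadratic pencil, where `X = Π₂* S⁻¹ Π₁` and
`Y = Π₂* S⁻¹ A₁ Π₁`. -/
def dressedQ0 (Q0 Q1 Q2 X Y : Matrix μ μ ℂ) : Matrix μ μ ℂ :=
  Q0 - Q1 * X + X * Q1 - Q2 * Y + Y * Q2 + Q2 * X * X - X * Q2 * X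

omit [DecidableEq μ] in
theorem hasEntryDerivAt_mul_inv
    (hP : HasEntryDerivAt P (-(Q0 * P s + Q1 * P s * A2 + Q2 * P s * A2 ^ 2)) s)
    (hS : HasEntryDerivAt S (B s * Q1 * P s + A1 * (B s * Q2 * P s) + B s * Q2 * P s * A2) s)
    (hId : A1 * S s - S s * A2 = B s * P s) (hu : IsUnit (S s)) :
    HasEntryDerivAt (fun s' => P s' * (S s')⁻¹)
      (-(dressedQ0 Q0 Q1 Q2 (P s * (S s)⁻¹ * B s) (P s * (S s)⁻¹ * A1 * B s) * (P s * (S s)⁻¹)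
        + (Q1 - Q2 * (P s * (S s)⁻¹ * B s) + P s * (S s)⁻¹ * B s * Q2) * (P s * (S s)⁻¹) * A1
        + Q2 * (P s * (S s)⁻¹) * A1 ^ 2)) s := by
  convert hP.mul (hS.inv hu) using 1
  have hdet := (Matrix.isUnit_iff_isUnit_det _).1 hu
  have hA : A2 * (S s)⁻¹ = (S s)⁻¹ * A1 - (S s)⁻¹ * (B s * (P s * (S s)⁻¹)) := by
    have h : (S s)⁻¹ * (A1 * S s - S s * A2) * (S s)⁻¹ = (S s)⁻¹ * (B s * P s) * (S s)⁻¹ := by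
      rw [hId]
    rw [Matrix.mul_sub, Matrix.sub_mul, Matrix.mul_assoc, Matrix.mul_assoc A1,
      Matrix.mul_nonsing_inv _ hdet, Matrix.nonsing_inv_mul_cancel_left _ _ hdet] at h
    simp only [Matrix.mul_one, Matrix.mul_assoc] at h
    rw [← h]; abel
  have hA' (Y : Matrix ν ν ℂ) : A2 * ((S s)⁻¹ * Y)
      = (S s)⁻¹ * (A1 * Y) - (S s)⁻¹ * (B s * (P s * ((S s)⁻¹ * Y))) := by
    rw [← Matrix.mul_assoc, hA]; simp only [Matrix.sub_mul, Matrix.mul_assoc]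
  simp only [dressedQ0, pow_two, Matrix.mul_assoc, Matrix.add_mul, Matrix.sub_mul, Matrix.mul_add,
    Matrix.mul_sub, Matrix.neg_mul, Matrix.mul_neg, hA, hA']
  abel

/-- Derivative of the Darboux matrix in terms of the original and the transformed pencil. -/
theorem hasEntryDerivAt_darboux
    (hP : HasEntryDerivAt P (-(Q0 * P s + Q1 * P s * A2 + Q2 * P s * A2 ^ 2)) s)
    (hS : HasEntryDerivAt S (B s * Q1 * P s + A1 * (B s * Q2 * P s) + B s * Q2 * P s * A2) s)
    (hB : HasEntryDerivAt B (B s * Q0 + A1 * B s * Q1 + A1 ^ 2 * B s * Q2) s)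
    (hId : A1 * S s - S s * A2 = B s * P s) (hu : IsUnit (S s))
    {z : ℂ} (hz : IsUnit (A1 - z • (1 : Matrix ν ν ℂ))) :
    HasEntryDerivAt (fun s' => 1 - P s' * (S s')⁻¹ * (A1 - z • 1)⁻¹ * B s')
      (-(z ^ 2 • Q2 + z • (Q1 - Q2 * (P s * (S s)⁻¹ * B s) + P s * (S s)⁻¹ * B s * Q2)
          + dressedQ0 Q0 Q1 Q2 (P s * (S s)⁻¹ * B s) (P s * (S s)⁻¹ * A1 * B s))
          * (1 - P s * (S s)⁻¹ * (A1 - z • 1)⁻¹ * B s)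
        + (1 - P s * (S s)⁻¹ * (A1 - z • 1)⁻¹ * B s) * (z ^ 2 • Q2 + z • Q1 + Q0)) s := by
  have hK := hasEntryDerivAt_mul_inv hP hS hId hu
  convert (HasEntryDerivAt.const (1 : Matrix μ μ ℂ)).sub
    ((hK.mul (HasEntryDerivAt.const (A1 - z • (1 : Matrix ν ν ℂ))⁻¹)).mul hB) using 1
  have hdet := (Matrix.isUnit_iff_isUnit_det _).1 hz
  generalize hT : (A1 - z • (1 : Matrix ν ν ℂ))⁻¹ = T
  have h1 : A1 * T = 1 + z • T := by
    have := Matrix.mul_nonsing_inv _ hdet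
    rw [hT, Matrix.sub_mul, Matrix.smul_mul, Matrix.one_mul] at this
    rw [← this]; abel
  have h2 : T * A1 = 1 + z • T := by
    have := Matrix.nonsing_inv_mul _ hdet
    rw [hT, Matrix.mul_sub, Matrix.mul_smul, Matrix.mul_one] at this
    rw [← this]; abel
  have h1' (Y : Matrix ν μ ℂ) : A1 * (T * Y) = Y + z • (T * Y) := by
    rw [← Matrix.mul_assoc, h1]; simp [Matrix.add_mul]
  have h2' (Y : Matrix ν μ ℂ) : T * (A1 * Y) = Y + z • (T * Y) := by
    rw [← Matrix.mul_assoc, h2]; simp [Matrix.add_mul]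
  generalize P s * (S s)⁻¹ = K
  simp only [dressedQ0, pow_two, Matrix.mul_assoc, Matrix.add_mul, Matrix.sub_mul, Matrix.mul_add,
    Matrix.mul_sub, Matrix.neg_mul, h1', h2', Matrix.mul_one, Matrix.one_mul,
    Matrix.smul_mul, Matrix.mul_smul, Matrix.mul_zero, Matrix.zero_mul, smul_add, smul_sub]
  module

end Dressing

/-- Multiplying the Darboux matrix by a solution of the original system. -/
theorem HasEntryDerivAt.darboux_mul {μ : Type*} [Fintype μ] {D W : ℝ → Matrix μ μ ℂ}
    {F F' : Matrix μ μ ℂ} {s : ℝ} (hD : HasEntryDerivAt D (-F' * D s + D s * F) s)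
    (hW : HasEntryDerivAt W (-F * W s) s) :
    HasEntryDerivAt (fun s' => D s' * W s') (-F' * (D s * W s)) s := by
  convert hD.mul hW using 1
  simp only [Matrix.add_mul, Matrix.mul_assoc, Matrix.neg_mul, Matrix.mul_neg]
  abel

theorem fromBlocks_mul_jmat {m1 m2 : ℕ} (a : Matrix (Fin m1) (Fin m2) ℂ)
    (b : Matrix (Fin m2) (Fin m1) ℂ) :
    Matrix.fromBlocks 0 a b 0 * jmat m1 m2 = -(jmat m1 m2 * Matrix.fromBlocks 0 a b 0) := by
  simp [jmat, Matrix.fromBlocks_multiply, Matrix.fromBlocks_neg]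

/-- The dressed coefficient of the coupled NLS pencil has again the form `i (j ξ̃² − ξ̃_x)`. -/
theorem dressedQ0_nls {μ : Type*} [Fintype μ] [DecidableEq μ] {j ξ ξ' X Y : Matrix μ μ ℂ}
    (hj : j * j = 1) (hξ : ξ * j = -(j * ξ)) :
    dressedQ0 (Complex.I • (j * ξ ^ 2 - ξ')) ((-2 : ℂ) • (j * ξ)) ((-(2 * Complex.I)) • j) X Y
      = Complex.I • (j * (ξ + Complex.I • (j * X * j - X)) ^ 2
        - (ξ' + Complex.I •
          (j * (-(dressedQ0 (j * ξ) (Complex.I • j) 0 X Y * X + Complex.I • j * Y)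
              + (X * (j * ξ) + Y * (Complex.I • j))) * j
            - (-(dressedQ0 (j * ξ) (Complex.I • j) 0 X Y * X + Complex.I • j * Y)
              + (X * (j * ξ) + Y * (Complex.I • j)))))) := by
  have hj' (Z : Matrix μ μ ℂ) : j * (j * Z) = Z := by rw [← Matrix.mul_assoc, hj, Matrix.one_mul]
  have hξ' (Z : Matrix μ μ ℂ) : ξ * (j * Z) = -(j * (ξ * Z)) := by
    rw [← Matrix.mul_assoc, hξ, Matrix.neg_mul, Matrix.mul_assoc]
  have hI : Complex.I * Complex.I = -1 := Complex.I_mul_I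
  simp only [dressedQ0, pow_two, Matrix.mul_assoc, Matrix.add_mul, Matrix.sub_mul, Matrix.mul_add,
    Matrix.mul_sub, hj, hj', hξ, hξ', Matrix.smul_mul, Matrix.mul_smul, Matrix.mul_zero, Matrix.zero_mul, smul_add,
    smul_sub, smul_smul, hI, neg_mul, mul_neg, mul_one, smul_neg, neg_smul, neg_neg]
  module

/-- The spatial derivative of `X₀ = Π₂* S⁻¹ Π₁`. -/
theorem hasEntryDerivAt_mul_inv_mul {μ ν : Type*} [Fintype μ] [Fintype ν] [DecidableEq ν]
    {A1 A2 : Matrix ν ν ℂ} {B : ℝ → Matrix ν μ ℂ} {P : ℝ → Matrix μ ν ℂ} {S : ℝ → Matrix ν ν ℂ}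
    {q0 q1 : Matrix μ μ ℂ} {s : ℝ}
    (hP : HasEntryDerivAt P (-(q0 * P s + q1 * P s * A2)) s)
    (hS : HasEntryDerivAt S (B s * q1 * P s) s)
    (hB : HasEntryDerivAt B (B s * q0 + A1 * B s * q1) s)
    (hId : A1 * S s - S s * A2 = B s * P s) (hu : IsUnit (S s)) :
    HasEntryDerivAt (fun s' => P s' * (S s')⁻¹ * B s')
      (-(dressedQ0 q0 q1 0 (P s * (S s)⁻¹ * B s) (P s * (S s)⁻¹ * A1 * B s)
            * (P s * (S s)⁻¹ * B s) + q1 * (P s * (S s)⁻¹ * A1 * B s))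
        + (P s * (S s)⁻¹ * B s * q0 + P s * (S s)⁻¹ * A1 * B s * q1)) s := by
  have hK := hasEntryDerivAt_mul_inv (Q0 := q0) (Q1 := q1) (Q2 := 0) (by simpa using hP)
    (by simpa using hS) hId hu
  convert hK.mul hB using 1
  simp [Matrix.mul_assoc, Matrix.add_mul, Matrix.mul_add, Matrix.neg_mul]

/-- Proposition 2.4: `w̃ = w_A w` satisfies the transformed auxiliary
systems `w̃_x = G̃ w̃`, `w̃_t = F̃ w̃` with coefficients built from the GBDT-transformed
potential `ξ̃`. -/
theorem gbdt_darboux_wave_function (m1 m2 n : ℕ)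
    (v1 : ℝ → ℝ → Matrix (Fin m1) (Fin m2) ℂ)
    (v2 : ℝ → ℝ → Matrix (Fin m2) (Fin m1) ℂ)
    (ξ ξx ξxx ξt : ℝ → ℝ → Matrix (Fin m1 ⊕ Fin m2) (Fin m1 ⊕ Fin m2) ℂ)
    (hblock : ∀ x t, ξ x t = Matrix.fromBlocks 0 (v1 x t) (v2 x t) 0)
    (hξx : ∀ x t, ∀ i k, HasDerivAt (fun x' => ξ x' t i k) (ξx x t i k) x)
    (hξxx : ∀ x t, ∀ i k, HasDerivAt (fun x' => ξx x' t i k) (ξxx x t i k) x)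
    (hξt : ∀ x t, ∀ i k, HasDerivAt (fun t' => ξ x t' i k) (ξt x t i k) t)
    (hC2 : ∀ i k, Continuous (fun p : ℝ × ℝ => ξx p.1 p.2 i k)
      ∧ Continuous (fun p : ℝ × ℝ => ξxx p.1 p.2 i k)
      ∧ Continuous (fun p : ℝ × ℝ => ξt p.1 p.2 i k))
    (hNLS : ∀ x t, ξt x t + Complex.I • (jmat m1 m2 * ξxx x t)
      + (2 * Complex.I) • (jmat m1 m2 * (ξ x t) ^ 3) = 0)
    (A1 A2 : Matrix (Fin n) (Fin n) ℂ)
    (Pi1 Pi2 : ℝ → ℝ → Matrix (Fin n) (Fin m1 ⊕ Fin m2) ℂ)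
    (S : ℝ → ℝ → Matrix (Fin n) (Fin n) ℂ)
    (hPi1x : ∀ x t, ∀ i k, HasDerivAt (fun x' => Pi1 x' t i k)
      ((Pi1 x t * q0m m1 m2 ξ x t + A1 * Pi1 x t * q1m m1 m2) i k) x)
    (hPi1t : ∀ x t, ∀ i k, HasDerivAt (fun t' => Pi1 x t' i k)
      (((Pi1 x t * Q0m m1 m2 ξ ξx x t + A1 * Pi1 x t * Q1m m1 m2 ξ x t
        + A1 ^ 2 * Pi1 x t * Q2m m1 m2 : Matrix (Fin n) (Fin m1 ⊕ Fin m2) ℂ)) i k) t)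
    (hPi2x : ∀ x t, ∀ i k, HasDerivAt (fun x' => Pi2 x' t i k)
      ((-(Pi2 x t * (q0m m1 m2 ξ x t)ᴴ + A2ᴴ * Pi2 x t * (q1m m1 m2)ᴴ)) i k) x)
    (hPi2t : ∀ x t, ∀ i k, HasDerivAt (fun t' => Pi2 x t' i k)
      (((-(Pi2 x t * (Q0m m1 m2 ξ ξx x t)ᴴ + A2ᴴ * Pi2 x t * (Q1m m1 m2 ξ x t)ᴴ
        + (A2ᴴ) ^ 2 * Pi2 x t * (Q2m m1 m2)ᴴ) : Matrix (Fin n) (Fin m1 ⊕ Fin m2) ℂ)) i k) t)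
    (hSx : ∀ x t, ∀ i k, HasDerivAt (fun x' => S x' t i k)
      ((Pi1 x t * q1m m1 m2 * (Pi2 x t)ᴴ) i k) x)
    (hSt : ∀ x t, ∀ i k, HasDerivAt (fun t' => S x t' i k)
      ((Pi1 x t * Q1m m1 m2 ξ x t * (Pi2 x t)ᴴ + A1 * (Pi1 x t * Q2m m1 m2 * (Pi2 x t)ᴴ)
        + Pi1 x t * Q2m m1 m2 * (Pi2 x t)ᴴ * A2) i k) t)
    (hId : ∀ x t, A1 * S x t - S x t * A2 = Pi1 x t * (Pi2 x t)ᴴ)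
    (z : ℂ) (hz : IsUnit (A1 - z • (1 : Matrix (Fin n) (Fin n) ℂ)))
    (Ω : Set (ℝ × ℝ)) (hΩ : IsOpen Ω)
    (hSinv : ∀ p ∈ Ω, IsUnit (S p.1 p.2))
    (w : ℝ → ℝ → Matrix (Fin m1 ⊕ Fin m2) (Fin m1 ⊕ Fin m2) ℂ)
    (hwx : ∀ p ∈ Ω, ∀ i k, HasDerivAt (fun x' => w x' p.2 i k)
      ((Gm m1 m2 ξ z p.1 p.2 * w p.1 p.2) i k) p.1)
    (hwt : ∀ p ∈ Ω, ∀ i k, HasDerivAt (fun t' => w p.1 t' i k)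
      ((Fm m1 m2 ξ ξx z p.1 p.2 * w p.1 p.2) i k) p.2) :
    ∀ p ∈ Ω, ∀ i k,
      HasDerivAt (fun x' => (wAm m1 m2 n A1 Pi1 Pi2 S x' p.2 z * w x' p.2) i k)
        ((-(z • (Complex.I • jmat m1 m2) + jmat m1 m2 * xiT m1 m2 n ξ Pi1 Pi2 S p.1 p.2)
          * (wAm m1 m2 n A1 Pi1 Pi2 S p.1 p.2 z * w p.1 p.2)) i k) p.1
      ∧ HasDerivAt (fun t' => (wAm m1 m2 n A1 Pi1 Pi2 S p.1 t' z * w p.1 t') i k)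
        ((-(z ^ 2 • ((-(2 * Complex.I)) • jmat m1 m2)
            + z • ((-2 : ℂ) • (jmat m1 m2 * xiT m1 m2 n ξ Pi1 Pi2 S p.1 p.2))
            + Complex.I • (jmat m1 m2 * (xiT m1 m2 n ξ Pi1 Pi2 S p.1 p.2) ^ 2
              - xiTx m1 m2 n ξ Pi1 Pi2 S p.1 p.2))
          * (wAm m1 m2 n A1 Pi1 Pi2 S p.1 p.2 z * w p.1 p.2)) i k) p.2 := by
  intro p hp
  obtain ⟨x, t⟩ := p
  have hu := hSinv _ hp
  have hid := hId x t
  have hj := jmat_mul_self m1 m2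
  have hξj : ξ x t * jmat m1 m2 = -(jmat m1 m2 * ξ x t) := by
    rw [hblock]; exact fromBlocks_mul_jmat _ _
  have hPx : HasEntryDerivAt (fun x' => (Pi2 x' t)ᴴ)
      (-(q0m m1 m2 ξ x t * (Pi2 x t)ᴴ + q1m m1 m2 * (Pi2 x t)ᴴ * A2)) x := by
    have := HasEntryDerivAt.conjTranspose (hPi2x x t)
    simpa [Matrix.conjTranspose_mul, Matrix.mul_assoc] using this
  have hPt : HasEntryDerivAt (fun t' => (Pi2 x t')ᴴ)
      (-(Q0m m1 m2 ξ ξx x t * (Pi2 x t)ᴴ + Q1m m1 m2 ξ x t * (Pi2 x t)ᴴ * A2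
        + Q2m m1 m2 * (Pi2 x t)ᴴ * A2 ^ 2)) t := by
    have := HasEntryDerivAt.conjTranspose (hPi2t x t)
    simpa [Matrix.conjTranspose_mul, Matrix.mul_assoc] using this
  have hSx' : HasEntryDerivAt (fun x' => S x' t) (Pi1 x t * q1m m1 m2 * (Pi2 x t)ᴴ) x := hSx x t
  have hBx : HasEntryDerivAt (fun x' => Pi1 x' t)
    (Pi1 x t * q0m m1 m2 ξ x t + A1 * Pi1 x t * q1m m1 m2) x := hPi1x x t
  have hX := hasEntryDerivAt_mul_inv_mul (P := fun x' => (Pi2 x' t)ᴴ)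
    (B := fun x' => Pi1 x' t) (S := fun x' => S x' t) (s := x) hPx hSx' hBx hid hu
  have hDx := hasEntryDerivAt_darboux (P := fun x' => (Pi2 x' t)ᴴ) (B := fun x' => Pi1 x' t)
    (S := fun x' => S x' t) (Q0 := q0m m1 m2 ξ x t) (Q1 := q1m m1 m2) (Q2 := 0) (A2 := A2) (s := x)
    (by simpa using hPx) (by simpa using hSx')
    (by simpa using hBx) hid hu hz
  have hDt := hasEntryDerivAt_darboux (P := fun t' => (Pi2 x t')ᴴ) (B := fun t' => Pi1 x t')
    (S := fun t' => S x t') hPt (hSt x t) (hPi1t x t) hid hu hz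
  have hξT : HasEntryDerivAt (fun x' => xiT m1 m2 n ξ Pi1 Pi2 S x' t) _ x :=
    HasEntryDerivAt.add (M := fun x' => ξ x' t) (hξx x t) (HasEntryDerivAt.const_smul Complex.I
      (HasEntryDerivAt.sub (M := fun x' => jmat m1 m2 * X0m m1 m2 n Pi1 Pi2 S x' t * jmat m1 m2)
        (HasEntryDerivAt.mul (HasEntryDerivAt.mul (HasEntryDerivAt.const (jmat m1 m2)) hX)
        (HasEntryDerivAt.const (jmat m1 m2))) hX))
  have hξTx : xiTx m1 m2 n ξ Pi1 Pi2 S x t = _ := Matrix.ext fun i k => (hξT i k).deriv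
  have hq0 : dressedQ0 (q0m m1 m2 ξ x t) (q1m m1 m2) 0 ((Pi2 x t)ᴴ * (S x t)⁻¹ * Pi1 x t)
      ((Pi2 x t)ᴴ * (S x t)⁻¹ * A1 * Pi1 x t) = jmat m1 m2 * xiT m1 m2 n ξ Pi1 Pi2 S x t := by
    simp only [dressedQ0, q0m, q1m, xiT, X0m, Matrix.mul_add, Matrix.mul_sub, Matrix.mul_smul,
      Matrix.smul_mul, ← Matrix.mul_assoc, hj, Matrix.one_mul, Matrix.zero_mul, Matrix.mul_zero]
    module
  have hQ1 : Q1m m1 m2 ξ x t - Q2m m1 m2 * ((Pi2 x t)ᴴ * (S x t)⁻¹ * Pi1 x t)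
      + (Pi2 x t)ᴴ * (S x t)⁻¹ * Pi1 x t * Q2m m1 m2
      = (-2 : ℂ) • (jmat m1 m2 * xiT m1 m2 n ξ Pi1 Pi2 S x t) := by
    simp only [Q1m, Q2m, xiT, X0m, Matrix.mul_add, Matrix.mul_sub, Matrix.mul_smul,
      Matrix.smul_mul, ← Matrix.mul_assoc, hj, Matrix.one_mul]
    module
  have hQ0 : dressedQ0 (Q0m m1 m2 ξ ξx x t) (Q1m m1 m2 ξ x t) (Q2m m1 m2)
      ((Pi2 x t)ᴴ * (S x t)⁻¹ * Pi1 x t) ((Pi2 x t)ᴴ * (S x t)⁻¹ * A1 * Pi1 x t)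
      = Complex.I • (jmat m1 m2 * xiT m1 m2 n ξ Pi1 Pi2 S x t ^ 2
        - xiTx m1 m2 n ξ Pi1 Pi2 S x t) := by
    rw [Q0m, Q1m, Q2m, dressedQ0_nls hj hξj, hξTx]
    simp only [xiT, X0m, q0m, q1m, Matrix.mul_zero, Matrix.zero_mul, zero_add, add_zero]
  rw [hq0] at hDx
  rw [hQ1, hQ0] at hDt
  simp only [Matrix.mul_zero, Matrix.zero_mul, sub_zero, add_zero, zero_add, smul_zero] at hDx
  have hx := HasEntryDerivAt.darboux_mul (D := fun x' => wAm m1 m2 n A1 Pi1 Pi2 S x' t z)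
    (W := fun x' => w x' t) (s := x) hDx (hwx _ hp)
  have ht := HasEntryDerivAt.darboux_mul (D := fun t' => wAm m1 m2 n A1 Pi1 Pi2 S x t' z)
    (W := fun t' => w x t') (s := t) hDt (hwt _ hp)
  exact fun i k => ⟨hx i k, ht i k⟩
end

section
/- Let n, m ∈ ℕ, let A, S ∈ M_n(ℂ) with S invertible, let Π1, Π2 ∈ ℂ^{n×m}, and let J ∈ M_m(ℂ) satisfy J = J* and J² = I_m. Assume the matrix identity A S + S A* = Π1 J Π2*. Then for every z ∈ ℂ such that A − z I_n and A* + z I_n are both invertible, one has (I_m − J Π2* S^{-1} (A − z I_n)^{-1} Π1)(I_m − J Π2* (A* + z I_n)^{-1} S^{-1} Π1) = I_m; that is, the Darboux matrix w_A(z) := I_m − J Π2* S^{-1} (A − z I_n)^{-1} Π1 is invertible with inverse I_m − J Π2* (A* + z I_n)^{-1} S^{-1} Π1. -/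
open Matrix

/-- If `B S + S C = P K` with `B`, `C`, `S` invertible, then `1 - K C⁻¹ S⁻¹ P` is a right inverse
of `1 - K S⁻¹ B⁻¹ P`. -/
theorem one_sub_mul_one_sub_eq_one_of_sylvester {ι κ R : Type*} [Fintype ι] [DecidableEq ι]
    [Fintype κ] [DecidableEq κ] [CommRing R] {B C S : Matrix ι ι R} {P : Matrix ι κ R}
    {K : Matrix κ ι R} (hB : IsUnit B) (hC : IsUnit C) (hS : IsUnit S)
    (h : B * S + S * C = P * K) :
    (1 - K * S⁻¹ * B⁻¹ * P) * (1 - K * C⁻¹ * S⁻¹ * P) = 1 := by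
  rw [Matrix.isUnit_iff_isUnit_det] at hB hC hS
  have key : S⁻¹ * B⁻¹ * (P * K) * C⁻¹ * S⁻¹ = C⁻¹ * S⁻¹ + S⁻¹ * B⁻¹ := by
    simp [← h, mul_add, add_mul, Matrix.mul_assoc, hB, hC, hS]
  have hprod : K * S⁻¹ * B⁻¹ * P * (K * C⁻¹ * S⁻¹ * P) =
      K * C⁻¹ * S⁻¹ * P + K * S⁻¹ * B⁻¹ * P := by
    calc
      _ = K * (S⁻¹ * B⁻¹ * (P * K) * C⁻¹ * S⁻¹) * P := by simp only [Matrix.mul_assoc]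
      _ = _ := by rw [key]; simp only [Matrix.mul_add, Matrix.add_mul, Matrix.mul_assoc]
  rw [sub_mul, mul_sub, mul_sub, hprod, one_mul, one_mul, mul_one]
  abel

/-- Remark 3.3, invertibility of the Darboux matrix: if
`A S + S A* = Π1 J Π2*` with `S` invertible and `J = J*`, `J² = I`, then for every `z`
with `A − zI` and `A* + zI` invertible, the Darboux matrix
`w_A(z) = I − J Π2* S⁻¹ (A − zI)⁻¹ Π1` has inverse `I − J Π2* (A* + zI)⁻¹ S⁻¹ Π1`. -/
theorem darboux_matrix_inverse (n m : ℕ)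
    (A S : Matrix (Fin n) (Fin n) ℂ) (hS : IsUnit S)
    (Pi1 Pi2 : Matrix (Fin n) (Fin m) ℂ)
    (J : Matrix (Fin m) (Fin m) ℂ) (hJherm : J = Jᴴ) (hJ2 : J * J = 1)
    (hId : A * S + S * Aᴴ = Pi1 * J * Pi2ᴴ)
    (z : ℂ) (hAz : IsUnit (A - z • (1 : Matrix (Fin n) (Fin n) ℂ)))
    (hAz' : IsUnit (Aᴴ + z • (1 : Matrix (Fin n) (Fin n) ℂ))) :
    ((1 : Matrix (Fin m) (Fin m) ℂ)
        - J * Pi2ᴴ * S⁻¹ * (A - z • (1 : Matrix (Fin n) (Fin n) ℂ))⁻¹ * Pi1)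
      * ((1 : Matrix (Fin m) (Fin m) ℂ)
        - J * Pi2ᴴ * (Aᴴ + z • (1 : Matrix (Fin n) (Fin n) ℂ))⁻¹ * S⁻¹ * Pi1) = 1 := by
  refine one_sub_mul_one_sub_eq_one_of_sylvester hAz hAz' hS ?_
  rw [← Matrix.mul_assoc, ← hId, sub_mul, mul_add, smul_mul_assoc, mul_smul_comm, one_mul, mul_one]
  abel
end

section
/- Let a ∈ ℂ with a + conj(a) ≠ 0 and let A := a I₂ + A₀ ∈ M₂(ℂ), where A₀ is the 2×2 matrix with entry 1 in position (1,2) and zeros elsewhere. Suppose S = (s_{ik})_{i,k=1}^2 ∈ M₂(ℂ) and ω = (ω_{ik})_{i,k=1}^2 ∈ M₂(ℂ) satisfy the identity A S + S A* = ω. Then s₂₂ = ω₂₂/(a+conj(a)), s₂₁ = (ω₂₁ − s₂₂)/(a+conj(a)), s₁₂ = (ω₁₂ − s₂₂)/(a+conj(a)), s₁₁ = (ω₁₁ − s₁₂ − s₂₁)/(a+conj(a)), and det S = (a+conj(a))^{-2} ( ω₁₁ω₂₂ − ω₁₂ω₂₁ + (a+conj(a))^{-2} ω₂₂² ). -/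
open Matrix Complex ComplexConjugate

/-- Example 5.3, formulas (5.6)–(5.7): the entries and determinant of
the solution `S` of the Sylvester-type identity `A S + S A* = ω` for the Jordan cell
`A = aI₂ + A₀`. -/
theorem jordan_cell_sylvester (a : ℂ) (ha : a + conj a ≠ 0)
    (S ω : Matrix (Fin 2) (Fin 2) ℂ)
    (hId : (a • (1 : Matrix (Fin 2) (Fin 2) ℂ) + !![0, 1; 0, 0]) * S
        + S * (a • (1 : Matrix (Fin 2) (Fin 2) ℂ) + !![0, 1; 0, 0])ᴴ = ω) :
    S 1 1 = ω 1 1 / (a + conj a)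
    ∧ S 1 0 = (ω 1 0 - S 1 1) / (a + conj a)
    ∧ S 0 1 = (ω 0 1 - S 1 1) / (a + conj a)
    ∧ S 0 0 = (ω 0 0 - S 0 1 - S 1 0) / (a + conj a)
    ∧ S.det = ((a + conj a) ^ 2)⁻¹
        * (ω 0 0 * ω 1 1 - ω 0 1 * ω 1 0 + ((a + conj a) ^ 2)⁻¹ * (ω 1 1) ^ 2) := by
  have h00 := congrFun₂ hId 0 0
  have h01 := congrFun₂ hId 0 1
  have h10 := congrFun₂ hId 1 0
  have h11 := congrFun₂ hId 1 1
  simp [Matrix.mul_apply, Fin.sum_univ_two] at h00 h01 h10 h11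
  refine ⟨?_, ?_, ?_, ?_, ?_⟩
  · rw [eq_div_iff ha]
    linear_combination h11
  · rw [eq_div_iff ha]
    linear_combination h10
  · rw [eq_div_iff ha]
    linear_combination h01
  · rw [eq_div_iff ha]
    linear_combination h00
  · rw [Matrix.det_fin_two, ← h00, ← h01, ← h10, ← h11]
    field_simp
    ring
end
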